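/- Let u and u' be unipotent elements of Sp(V,b). Then u and u' are conjugate in Sp(V,b) if and only if for every d ≥ 1 the Jordan block multiplicity of size d of u on V equals that of u', and ε_{V,b}(d) computed for u equals ε_{V,b}(d) computed for u'. -/

import Mathlib

open Module LinearMap

noncomputable section

/-- Multiplicity of a Jordan block of size `d` of a unipotent map `u`, computed from
`f = u - 1` as `rank f^(d-1) - 2 rank f^d + rank f^(d+1)`. -/
def jordanMult (K : Type*) [Field K] {V : Type*} [AddCommGroup V] [Module K V]
    (f : V →ₗ[K] V) (d : ℕ) : ℕ :=
  Module.finrank K (LinearMap.range (f ^ (d - 1))) +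
    Module.finrank K (LinearMap.range (f ^ (d + 1))) -
    2 * Module.finrank K (LinearMap.range (f ^ d))

open Classical in
/-- The invariant ε_{V,b}(d) of Hesselink/Spaltenstein, computed from `f = u - 1`. -/
def eps (K : Type*) [Field K] {V : Type*} [AddCommGroup V] [Module K V]
    (f : V →ₗ[K] V) (b : V →ₗ[K] V →ₗ[K] K) (d : ℕ) : ℕ :=
  if ∃ v : V, (f ^ d) v = 0 ∧ b ((f ^ (d - 1)) v) v ≠ 0 then 1 else 0

/-- A linear endomorphism is unipotent if `(f - 1)^N = 0` for some `N`. -/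
def IsUnipotent (K : Type*) [Field K] {V : Type*} [AddCommGroup V] [Module K V]
    (f : V →ₗ[K] V) : Prop :=
  ∃ N : ℕ, (f - 1) ^ N = 0

/-- The standard single unipotent Jordan block of size `m` over `K`. -/
def jordanBlockMap (K : Type*) [Field K] (m : ℕ) : (Fin m → K) →ₗ[K] (Fin m → K) :=
  Matrix.toLin' (1 + Matrix.of fun i j : Fin m => if (i : ℕ) + 1 = (j : ℕ) then 1 else 0)

end


set_option linter.unusedSectionVars false
section Aux
variable {K : Type*} [Field K] [CharP K 2] {V : Type*} [AddCommGroup V] [Module K V]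

/-- An alternating form together with `f = u - 1`, where `u` preserves the form. -/
structure SpFrm (b : V →ₗ[K] V →ₗ[K] K) (f : V →ₗ[K] V) : Prop where
  alt : ∀ v, b v v = 0
  rel : ∀ x y, b (f x) y + b x (f y) + b (f x) (f y) = 0

/-- `U` is the inverse of `1 + f`. -/
structure InvOf (U f : V →ₗ[K] V) : Prop where
  comm : Commute U f
  inv : U + U * f = 1

theorem exists_invOf {f : V →ₗ[K] V} (hf : IsNilpotent f) : ∃ U, InvOf U f := by
  obtain ⟨u, hu⟩ := hf.isUnit_one_add
  refine ⟨↑u⁻¹, ?_, ?_⟩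
  · have h : Commute (u : V →ₗ[K] V) f := by
      rw [hu]; exact (Commute.one_left f).add_left (Commute.refl f)
    exact h.units_inv_left
  · have := u.inv_mul
    rw [hu, mul_add, mul_one] at this
    exact this

theorem two_zero (K : Type*) [Field K] [CharP K 2] : (2 : K) = 0 := CharTwo.two_eq_zero

theorem quad [IsAlgClosed K] (c p : K) : ∃ a : K, p + a + a ^ 2 * c = 0 := by
  by_cases hc : c = 0
  · exact ⟨-p, by simp [hc]⟩
  · open Polynomial in
    have hd : (C c * X ^ 2 + C 1 * X + C p : K[X]).degree = 2 := degree_quadratic hc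
    open Polynomial in
    obtain ⟨a, ha⟩ := IsAlgClosed.exists_root (C c * X ^ 2 + C 1 * X + C p : K[X])
      (by rw [hd]; decide)
    refine ⟨a, ?_⟩
    simp [Polynomial.IsRoot] at ha
    linear_combination ha

namespace SpFrm
variable {b : V →ₗ[K] V →ₗ[K] K} {f U : V →ₗ[K] V}

theorem symm (h : SpFrm b f) (x y : V) : b x y = b y x := by
  have h1 := h.alt (x + y)
  simp only [map_add, LinearMap.add_apply, h.alt] at h1
  linear_combination h1 - b y x * two_zero K

theorem adj (h : SpFrm b f) (hU : InvOf U f) (x y : V) : b x (f y) = b ((U * f) x) y := by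
  have h0 : x = U x + f (U x) := by
    have := congrArg (fun g : V →ₗ[K] V => g x) hU.inv
    simp only [hU.comm.eq] at this
    exact this.symm
  have h1 := h.rel (U x) y
  rw [hU.comm.eq]
  conv_lhs => rw [h0]
  simp only [map_add, LinearMap.add_apply, Module.End.mul_apply]
  linear_combination h1 - b (f (U x)) y * two_zero K

theorem adjn (h : SpFrm b f) (hU : InvOf U f) (n : ℕ) (x y : V) :
    b x ((f ^ n) y) = b ((U ^ n * f ^ n) x) y := by
  induction n generalizing x y with
  | zero => simp
  | succ n ih =>
    rw [← hU.comm.mul_pow, pow_succ', pow_succ, Module.End.mul_apply, h.adj hU, ih,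
      ← hU.comm.mul_pow, Module.End.mul_apply, Module.End.mul_apply, Module.End.mul_apply]

theorem _root_.InvOf.top (hU : InvOf U f) {n : ℕ} (hn : f ^ (n + 1) = 0) (k : ℕ) :
    U ^ k * f ^ n = f ^ n := by
  induction k with
  | zero => simp
  | succ k ih =>
    have : U * f ^ n = f ^ n := by
      have := congrArg (fun g => g * f ^ n) hU.inv
      simp only [add_mul, mul_assoc, ← pow_succ', hn, one_mul] at this
      simpa using this
    rw [pow_succ, mul_assoc, this, ih]

theorem _root_.pow_big {f : V →ₗ[K] V} {n k : ℕ} (hn : f ^ n = 0) (h : n ≤ k) : f ^ k = 0 :=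
  pow_eq_zero_of_le h hn

theorem b_zero (h : SpFrm b f) (hU : InvOf U f) {n a c : ℕ} (hn : f ^ (n + 1) = 0)
    (hac : n + 1 ≤ a + c) (x y : V) : b ((f ^ a) x) ((f ^ c) y) = 0 := by
  rw [h.adjn hU, ← Module.End.mul_apply, mul_assoc, ← pow_add, pow_big hn (by omega)]
  simp

theorem b_top (h : SpFrm b f) (hU : InvOf U f) {n a c : ℕ} (hn : f ^ (n + 1) = 0)
    (hac : a + c = n) (x y : V) : b ((f ^ a) x) ((f ^ c) y) = b ((f ^ n) x) y := by
  rw [h.adjn hU, ← Module.End.mul_apply, mul_assoc, ← pow_add, add_comm c a, hac, hU.top hn]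

theorem B_symm (h : SpFrm b f) (hU : InvOf U f) {n : ℕ} (hn : f ^ (n + 1) = 0) (x y : V) :
    b ((f ^ n) x) y = b ((f ^ n) y) x := by
  rw [h.symm ((f ^ n) y) x]
  have := h.b_top hU hn (zero_add n) x y
  simpa using this.symm

/-- the self-adjoint operator `S`: `b (S x) y = b (f x) (f y)`. -/
theorem S_adj (h : SpFrm b f) (hU : InvOf U f) (x y : V) :
    b ((U * f ^ 2) x) y = b (f x) (f y) := by
  rw [h.adj hU, ← Module.End.mul_apply, mul_assoc, ← pow_two]

theorem S_sum (h : SpFrm b f) (hU : InvOf U f) (x y : V) :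
    b (f x) y + b x (f y) = b ((U * f ^ 2) x) y := by
  rw [h.S_adj hU]
  linear_combination h.rel x y - b (f x) (f y) * two_zero K

theorem S_self (h : SpFrm b f) (hU : InvOf U f) (x y : V) :
    b ((U * f ^ 2) x) y = b x ((U * f ^ 2) y) := by
  rw [h.S_adj hU, h.symm x, h.S_adj hU, h.symm]

theorem S_selfn (h : SpFrm b f) (hU : InvOf U f) (n : ℕ) (x y : V) :
    b (((U * f ^ 2) ^ n) x) y = b x (((U * f ^ 2) ^ n) y) := by
  induction n generalizing x y with
  | zero => simp
  | succ n ih =>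
    rw [pow_succ, Module.End.mul_apply, ih, h.S_self hU, ← Module.End.mul_apply, ← pow_succ', pow_succ]

theorem _root_.InvOf.S_pow (hU : InvOf U f) (n : ℕ) : (U * f ^ 2) ^ n = U ^ n * f ^ (2 * n) := by
  rw [(hU.comm.pow_right 2).mul_pow, ← pow_mul]

theorem _root_.InvOf.S_comm (hU : InvOf U f) (n : ℕ) : Commute ((U * f ^ 2) ^ n) f :=
  ((hU.comm.mul_left (Commute.pow_self f 2))).pow_left n

/-- the numbers `p_i(v)`. -/
theorem P_eq (h : SpFrm b f) (hU : InvOf U f) (i : ℕ) (v : V) :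
    b (((U * f ^ 2) ^ i) (f v)) v = b ((f ^ (i + 1)) v) ((f ^ i) v) := by
  rw [h.adjn hU i, hU.S_pow, pow_succ]
  simp only [← Module.End.mul_apply, mul_assoc, ← pow_succ, ← pow_add]
  congr 5
  omega

theorem P_zero (h : SpFrm b f) (hU : InvOf U f) {n : ℕ} (hn : f ^ (n + 1) = 0) {i : ℕ}
    (hi : n ≤ 2 * i) (v : V) : b (((U * f ^ 2) ^ i) (f v)) v = 0 := by
  rw [h.P_eq hU, h.b_zero hU hn (by omega)]

theorem P_top (h : SpFrm b f) (hU : InvOf U f) {n : ℕ} (hn : f ^ (n + 1) = 0) {i : ℕ}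
    (hi : 2 * i + 1 = n) (v : V) : b (((U * f ^ 2) ^ i) (f v)) v = b ((f ^ n) v) v := by
  rw [h.P_eq hU, h.b_top hU hn (by omega)]

theorem P_step (h : SpFrm b f) (hU : InvOf U f) (i l : ℕ) (a : K) (v : V) :
    b (((U * f ^ 2) ^ i) (f (v + a • ((U * f ^ 2) ^ l) (f v)))) (v + a • ((U * f ^ 2) ^ l) (f v))
      = b (((U * f ^ 2) ^ i) (f v)) v + a * b (((U * f ^ 2) ^ (i + l + 1)) (f v)) v
        + a ^ 2 * b (((U * f ^ 2) ^ (i + 2 * l + 1)) (f v)) v := by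
  set S := U * f ^ 2 with hS
  have hc : ∀ n x, (S ^ n) (f x) = f ((S ^ n) x) := fun n x => by
    rw [← Module.End.mul_apply, (hU.S_comm n).eq, Module.End.mul_apply]
  have hSS : ∀ n k x, (S ^ n) ((S ^ k) x) = (S ^ (n + k)) x := fun n k x => by
    rw [← Module.End.mul_apply, ← pow_add]
  have e1 : b ((S ^ i) (f v)) ((S ^ l) (f v)) = b ((S ^ (i + l)) (f v)) (f v) := by
    rw [← h.S_selfn hU, hSS, add_comm l i]
  have e2 : b ((S ^ i) (f ((S ^ l) (f v)))) v = b (f ((S ^ (i + l)) (f v))) v := by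
    rw [hc, hSS]
  have e3 : b ((S ^ i) (f ((S ^ l) (f v)))) ((S ^ l) (f v))
      = b ((S ^ (i + 2 * l + 1)) (f v)) v := by
    rw [← h.S_selfn hU, hc, ← hc, hSS, hc, hSS, ← h.S_adj hU]
    have : S ((S ^ (l + i + l)) (f v)) = (S ^ (i + 2 * l + 1)) (f v) := by
      have := hSS 1 (l + i + l) (f v)
      rw [pow_one] at this
      rw [this]; congr 2; omega
    rw [this]
  have e4 := h.S_sum hU ((S ^ (i + l)) (f v)) v
  have e5 : S ((S ^ (i + l)) (f v)) = (S ^ (i + l + 1)) (f v) := by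
    have := hSS 1 (i + l) (f v)
    rw [pow_one] at this
    rw [this]; congr 2; omega
  rw [← hS, e5] at e4
  simp only [map_add, map_smul, LinearMap.add_apply, LinearMap.smul_apply, smul_eq_mul, e1, e2, e3]
  linear_combination a * e4

theorem cyc_normal [IsAlgClosed K] (h : SpFrm b f) (hU : InvOf U f) {k : ℕ}
    (hn : f ^ (2 * k + 1 + 1) = 0) (v : V) (hv : b ((f ^ (2 * k + 1)) v) v ≠ 0) :
    ∃ v' : V, ∃ c : K, ∃ y : V, v' = c • v + f y ∧
      ∀ i, b ((f ^ (i + 1)) v') ((f ^ i) v') = if i = k then 1 else 0 := by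
  suffices H : ∀ t : ℕ, ∃ v' : V, ∃ c : K, ∃ y : V, v' = c • v + f y ∧
      ∀ i, k ≤ i + t → b (((U * f ^ 2) ^ i) (f v')) v' = if i = k then 1 else 0 by
    obtain ⟨v', c, y, h1, h2⟩ := H k
    exact ⟨v', c, y, h1, fun i => by rw [← h.P_eq hU, h2 i (by omega)]⟩
  intro t
  induction t with
  | zero =>
    obtain ⟨c, hc⟩ := IsAlgClosed.exists_pow_nat_eq (b ((f ^ (2 * k + 1)) v) v)⁻¹
      (n := 2) (by norm_num)
    refine ⟨c • v, c, 0, by simp, fun i hi => ?_⟩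
    split_ifs with hik
    · subst hik
      rw [h.P_top hU hn rfl]
      simp only [map_smul, LinearMap.smul_apply, smul_eq_mul]
      rw [← mul_assoc, ← pow_two, hc, inv_mul_cancel₀ hv]
    · exact h.P_zero hU hn (by omega) _
  | succ t ih =>
    obtain ⟨v', c, y, h1, h2⟩ := ih
    by_cases hk : k ≤ t
    · exact ⟨v', c, y, h1, fun i hi => h2 i (by omega)⟩
    obtain ⟨j, hj⟩ : ∃ j, k = j + t + 1 := ⟨k - t - 1, by omega⟩
    obtain ⟨a, ha⟩ := quad (b (((U * f ^ 2) ^ (j + 2 * t + 1)) (f v')) v')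
      (b (((U * f ^ 2) ^ j) (f v')) v')
    refine ⟨v' + a • ((U * f ^ 2) ^ t) (f v'), c, y + a • ((U * f ^ 2) ^ t) v', ?_, ?_⟩
    · rw [← Module.End.mul_apply, (hU.S_comm t).eq, Module.End.mul_apply, map_add, map_smul]
      rw [← add_assoc, ← h1]
    · intro i hi
      rw [h.P_step hU]
      by_cases hij : i = j
      · subst hij
        rw [h2 (i + t + 1) (by omega), if_pos hj.symm, if_neg (by omega)]
        linear_combination ha
      · rw [h2 i (by omega), h2 (i + t + 1) (by omega), h2 (i + 2 * t + 1) (by omega),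
          if_neg (show ¬ i + t + 1 = k by omega), if_neg (show ¬ i + 2 * t + 1 = k by omega)]
        ring

theorem iso_normal [IsAlgClosed K] (h : SpFrm b f) (hU : InvOf U f) {n : ℕ}
    (hn : f ^ (n + 1) = 0) (hq : ∀ x, b ((f ^ n) x) x = 0) (v w : V)
    (hvw : b ((f ^ n) v) w = 1) :
    ∃ v' : V, b ((f ^ n) v') w = 1 ∧ ∀ i, b ((f ^ (i + 1)) v') ((f ^ i) v') = 0 := by
  suffices H : ∀ t : ℕ, ∃ v' : V, b ((f ^ n) v') w = 1 ∧
      ∀ i, n ≤ i + t → b (((U * f ^ 2) ^ i) (f v')) v' = 0 by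
    obtain ⟨v', h1, h2⟩ := H n
    exact ⟨v', h1, fun i => by rw [← h.P_eq hU, h2 i (by omega)]⟩
  intro t
  induction t with
  | zero => exact ⟨v, hvw, fun i hi => h.P_zero hU hn (by omega) _⟩
  | succ t ih =>
    obtain ⟨v', h1, h2⟩ := ih
    by_cases hk : n ≤ t
    · exact ⟨v', h1, fun i hi => h2 i (by omega)⟩
    obtain ⟨j, hj⟩ : ∃ j, n = j + t + 1 := ⟨n - t - 1, by omega⟩
    by_cases hj2 : n ≤ 2 * j + 1
    · refine ⟨v', h1, fun i hi => ?_⟩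
      by_cases hij : n = 2 * i + 1
      · rw [h.P_top hU hn hij.symm, hq]
      · exact h.P_zero hU hn (by omega) _
    obtain ⟨r, hr⟩ : ∃ r, n = 2 * j + 2 + r := ⟨n - 2 * j - 2, by omega⟩
    set S := U * f ^ 2 with hS
    have hc : ∀ n x, (S ^ n) (f x) = f ((S ^ n) x) := fun n x => by
      rw [← Module.End.mul_apply, (hU.S_comm n).eq, Module.End.mul_apply]
    obtain ⟨a, ha⟩ := quad (b ((S ^ j) (f ((f ^ r) w))) ((f ^ r) w)) (b ((S ^ j) (f v')) v')
    have hP : ∀ i, b ((S ^ i) (f (v' + a • (f ^ r) w))) (v' + a • (f ^ r) w)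
        = b ((S ^ i) (f v')) v' + a * b ((S ^ (i + 1)) ((f ^ r) w)) v'
          + a ^ 2 * b ((S ^ i) (f ((f ^ r) w))) ((f ^ r) w) := by
      intro i
      have e1 := h.S_sum hU ((S ^ i) ((f ^ r) w)) v'
      have e2 : b ((S ^ i) (f v')) ((f ^ r) w) = b ((S ^ i) ((f ^ r) w)) (f v') := by
        rw [h.symm, ← h.S_selfn hU]
      rw [← hS, ← Module.End.mul_apply S, ← pow_succ', ← hc] at e1
      simp only [map_add, map_smul, LinearMap.add_apply, LinearMap.smul_apply, smul_eq_mul, e2]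
      linear_combination a * e1
    have hSf : ∀ i, S ^ i * f ^ r = U ^ i * f ^ (2 * i + r) := fun i => by
      rw [hU.S_pow, mul_assoc, ← pow_add]
    refine ⟨v' + a • (f ^ r) w, ?_, ?_⟩
    · simp only [map_add, map_smul, LinearMap.add_apply, LinearMap.smul_apply, smul_eq_mul, h1]
      rw [← Module.End.mul_apply, ← pow_add]
      rcases Nat.eq_zero_or_pos r with h0 | h0
      · rw [h0, add_zero, hq]; ring
      · rw [pow_big hn (by omega)]; simp
    · intro i hi
      rw [hP]
      by_cases hij : i = j
      · subst hij
        rw [← Module.End.mul_apply (S ^ (i + 1)), hSf,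
          show 2 * (i + 1) + r = n by omega, hU.top hn, h.B_symm hU hn, h1]
        linear_combination ha
      · rw [h2 i (by omega), ← Module.End.mul_apply (S ^ (i + 1)), hSf,
          pow_big hn (by omega : n + 1 ≤ 2 * (i + 1) + r)]
        have : b ((S ^ i) (f ((f ^ r) w))) ((f ^ r) w) = 0 := by
          rw [h.P_eq hU, ← Module.End.mul_apply, ← Module.End.mul_apply, ← pow_add, ← pow_add]
          exact h.b_zero hU hn (by omega) _ _
        rw [this]; simp

end SpFrm

/-- Gram data on a single vector is determined by the near-diagonal entries. -/
theorem gram_one (F F' : ℕ → ℕ → K) (hs : ∀ a c, F a c = F c a) (hs' : ∀ a c, F' a c = F' c a)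
    (h0 : ∀ a, F a a = 0) (h0' : ∀ a, F' a a = 0)
    (hr : ∀ a c, F (a + 1) c + F a (c + 1) + F (a + 1) (c + 1) = 0)
    (hr' : ∀ a c, F' (a + 1) c + F' a (c + 1) + F' (a + 1) (c + 1) = 0)
    (he : ∀ a, F (a + 1) a = F' (a + 1) a) (a c : ℕ) : F a c = F' a c := by
  have key : ∀ d, ∀ a, F a (a + d) = F' a (a + d) ∧ F a (a + (d + 1)) = F' a (a + (d + 1)) := by
    intro d
    induction d with
    | zero => intro a; exact ⟨by simp [h0, h0'], by rw [hs, hs']; exact he a⟩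
    | succ d ih =>
      intro a
      refine ⟨(ih a).2, ?_⟩
      have e1 := hr a (a + (d + 1))
      have e2 := hr' a (a + (d + 1))
      have e3 := (ih (a + 1)).1
      have e4 := (ih (a + 1)).2
      rw [show a + 1 + d = a + (d + 1) by omega] at e3
      rw [show a + 1 + (d + 1) = a + (d + 1) + 1 by omega] at e4
      rw [show a + (d + 1 + 1) = a + (d + 1) + 1 by omega]
      linear_combination e1 - e2 - e3 - e4
  rcases le_total a c with hac | hac
  · obtain ⟨d, rfl⟩ := Nat.exists_eq_add_of_le hac
    exact (key d a).1
  · obtain ⟨d, rfl⟩ := Nat.exists_eq_add_of_le hac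
    rw [hs, hs']; exact (key d c).1

theorem gram_two (F F' : ℕ → ℕ → K) (N : ℕ)
    (h0 : ∀ a c, N ≤ a → F a c = 0) (h0' : ∀ a c, N ≤ a → F' a c = 0)
    (hr : ∀ a c, F (a + 1) c + F a (c + 1) + F (a + 1) (c + 1) = 0)
    (hr' : ∀ a c, F' (a + 1) c + F' a (c + 1) + F' (a + 1) (c + 1) = 0)
    (he : ∀ a, F a 0 = F' a 0) (a c : ℕ) : F a c = F' a c := by
  induction c generalizing a with
  | zero => exact he a
  | succ c ih =>
    have key : ∀ t a, N ≤ a + t → F a (c + 1) = F' a (c + 1) := by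
      intro t
      induction t with
      | zero => intro a ha; rw [h0 _ _ (by omega), h0' _ _ (by omega)]
      | succ t iht =>
        intro a ha
        have e1 := hr a c
        have e2 := hr' a c
        linear_combination e1 - e2 - ih (a + 1) - iht (a + 1) (by omega)
    exact key N a (by omega)

namespace SpFrm
variable {b : V →ₗ[K] V →ₗ[K] K} {f U : V →ₗ[K] V}

theorem gram_rel (h : SpFrm b f) (v w : V) (a c : ℕ) :
    b ((f ^ (a + 1)) v) ((f ^ c) w) + b ((f ^ a) v) ((f ^ (c + 1)) w)
      + b ((f ^ (a + 1)) v) ((f ^ (c + 1)) w) = 0 := by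
  rw [pow_succ', pow_succ']
  exact h.rel _ _

theorem pair_normal [IsAlgClosed K] (h : SpFrm b f) (hU : InvOf U f) {n : ℕ}
    (hn : f ^ (n + 1) = 0) (hq : ∀ x, b ((f ^ n) x) x = 0) (v w : V)
    (hvw : b ((f ^ n) v) w = 1) :
    ∃ v w : V, (∀ a c, b ((f ^ a) v) ((f ^ c) v) = 0) ∧ (∀ a c, b ((f ^ a) w) ((f ^ c) w) = 0) ∧
      ∀ i, b ((f ^ i) v) w = if i = n then 1 else 0 := by
  have G : ∀ v, (∀ i, b ((f ^ (i + 1)) v) ((f ^ i) v) = 0) →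
      ∀ a c, b ((f ^ a) v) ((f ^ c) v) = 0 := fun v hv a c =>
    gram_one (fun a c => b ((f ^ a) v) ((f ^ c) v)) (fun _ _ => 0) (fun _ _ => h.symm _ _)
      (fun _ _ => rfl) (fun _ => h.alt _) (fun _ => rfl) (fun a c => h.gram_rel v v a c) (by simp)
      (by simpa using hv) a c
  obtain ⟨v, hvw, hv⟩ := h.iso_normal hU hn hq v w hvw
  rw [h.B_symm hU hn] at hvw
  obtain ⟨w, hvw, hw⟩ := h.iso_normal hU hn hq w v hvw
  rw [h.B_symm hU hn] at hvw
  replace hv := G v hv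
  replace hw := G w hw
  suffices H : ∀ t : ℕ, ∃ v' : V, (∀ a c, b ((f ^ a) v') ((f ^ c) v') = 0) ∧
      ∀ i, n ≤ i + t → b ((f ^ i) v') w = if i = n then 1 else 0 by
    obtain ⟨v', h1, h2⟩ := H n
    exact ⟨v', w, h1, hw, fun i => h2 i (by omega)⟩
  intro t
  induction t with
  | zero =>
    refine ⟨v, hv, fun i hi => ?_⟩
    split_ifs with hin
    · rw [hin, hvw]
    · rw [pow_big hn (by omega)]; simp
  | succ t ih =>
    obtain ⟨v', h1, h2⟩ := ih
    by_cases hk : n ≤ t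
    · exact ⟨v', h1, fun i hi => h2 i (by omega)⟩
    obtain ⟨j, hj⟩ : ∃ j, n = j + t + 1 := ⟨n - t - 1, by omega⟩
    refine ⟨v' - b ((f ^ j) v') w • (f ^ (t + 1)) v', ?_, ?_⟩
    · intro a c
      simp only [map_sub, map_smul, LinearMap.sub_apply, LinearMap.smul_apply, smul_eq_mul,
        ← Module.End.mul_apply, ← pow_add, h1]
      ring
    · intro i hi
      simp only [map_sub, map_smul, LinearMap.sub_apply, LinearMap.smul_apply, smul_eq_mul,
        ← Module.End.mul_apply, ← pow_add]
      rw [h2 (i + (t + 1)) (by omega)]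
      by_cases hij : i = j
      · subst hij
        rw [if_pos (by omega), if_neg (by omega)]; ring
      · rw [h2 i (by omega), if_neg (show ¬ i + (t + 1) = n by omega)]; ring

end SpFrm
end Aux

set_option linter.unusedSectionVars false

section Split
variable {K : Type*} [Field K] [CharP K 2]
variable {V : Type*} [AddCommGroup V] [Module K V]
variable {V' : Type*} [AddCommGroup V'] [Module K V']
variable {b : V →ₗ[K] V →ₗ[K] K} {f U : V →ₗ[K] V}
variable {b' : V' →ₗ[K] V' →ₗ[K] K} {f' : V' →ₗ[K] V'}

/-- the top form on `W / f W` is nondegenerate -/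
def NCond (b : V →ₗ[K] V →ₗ[K] K) (f : V →ₗ[K] V) (n : ℕ) (W : Submodule K V) : Prop :=
  ∀ z ∈ W, (∀ x ∈ W, b ((f ^ n) z) x = 0) → ∃ y ∈ W, z = f y

theorem sub_inv_pow {W : Submodule K V} (hW : ∀ x ∈ W, f x ∈ W) (k : ℕ) :
    ∀ x ∈ W, (f ^ k) x ∈ W := by
  induction k with
  | zero => simp
  | succ k ih => intro x hx; rw [pow_succ, Module.End.mul_apply]; exact ih _ (hW x hx)

theorem SpFrm.nondeg_sub (h : SpFrm b f) (hU : InvOf U f) {n : ℕ} (hn : f ^ (n + 1) = 0)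
    {W : Submodule K V} (hW : ∀ x ∈ W, f x ∈ W) (hN : NCond b f n W)
    (z : V) (hz : z ∈ W) (hz0 : ∀ x ∈ W, b z x = 0) : z = 0 := by
  have key : ∀ k, k ≤ n + 1 → ∃ y ∈ W, z = (f ^ k) y := by
    intro k
    induction k with
    | zero => intro _; exact ⟨z, hz, by simp⟩
    | succ k ih =>
      intro hk
      obtain ⟨y, hy, hzy⟩ := ih (by omega)
      obtain ⟨y', hy', e⟩ := hN y hy (fun x hx => by
        rw [← h.b_top hU hn (show k + (n - k) = n by omega), ← hzy]
        exact hz0 _ (sub_inv_pow hW _ _ hx))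
      exact ⟨y', hy', by rw [hzy, e, pow_succ, Module.End.mul_apply]⟩
  obtain ⟨y, -, e⟩ := key (n + 1) le_rfl
  rw [e, hn]; rfl

theorem SpFrm.eps_sub (h : SpFrm b f) (hU : InvOf U f) {n : ℕ} (hn : f ^ (n + 1) = 0)
    {W : Submodule K V} (hN : NCond b f n W)
    {e : ℕ} (he : e ≠ n) (x : V) (hx : x ∈ W) (hx0 : (f ^ (e + 1)) x = 0) :
    b ((f ^ e) x) x = 0 := by
  rcases lt_or_gt_of_ne he with he | he
  · have key : ∀ k, k ≤ n - e → ∃ y ∈ W, x = (f ^ k) y := by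
      intro k
      induction k with
      | zero => intro _; exact ⟨x, hx, by simp⟩
      | succ k ih =>
        intro hk
        obtain ⟨y, hy, hxy⟩ := ih (by omega)
        obtain ⟨y', hy', e⟩ := hN y hy (fun x' hx' => by
          have : (f ^ n) y = 0 := by
            have e1 : (f ^ n) y = (f ^ (n - k - (e + 1))) ((f ^ (e + 1)) ((f ^ k) y)) := by
              rw [← Module.End.mul_apply, ← Module.End.mul_apply, ← pow_add, ← pow_add]
              congr 2; omega
            rw [e1, ← hxy, hx0, map_zero]
          rw [this]; simp)
        exact ⟨y', hy', by rw [hxy, e, pow_succ, Module.End.mul_apply]⟩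
    obtain ⟨y, -, e1⟩ := key (n - e) le_rfl
    have : (f ^ e) x = (f ^ n) y := by
      rw [e1, ← Module.End.mul_apply, ← pow_add]; congr 2; omega
    rw [this, e1]
    exact h.b_zero hU hn (by omega) _ _
  · rw [pow_big hn (by omega)]; simp

theorem SpFrm.isCompl [FiniteDimensional K V] (h : SpFrm b f) {W : Submodule K V}
    (hnd : ∀ z ∈ W, (∀ x ∈ W, b z x = 0) → z = 0) :
    IsCompl W (LinearMap.BilinForm.orthogonal b W) := by
  apply LinearMap.BilinForm.isCompl_orthogonal_of_restrict_nondegenerate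
  · intro x y hxy; rw [h.symm]; exact hxy
  · constructor
    · intro x hx
      exact Subtype.ext (hnd x x.2 (fun y hy => hx ⟨y, hy⟩))
    · intro x hx
      exact Subtype.ext (hnd x x.2 (fun y hy => by rw [h.symm]; exact hx ⟨y, hy⟩))

theorem SpFrm.orth_inv (h : SpFrm b f) (hf : IsNilpotent f) {W : Submodule K V}
    (hW : ∀ x ∈ W, f x ∈ W) (x : V) (hx : ∀ w ∈ W, b w x = 0) : ∀ w ∈ W, b w (f x) = 0 := by
  have key : ∀ k, ∀ w ∈ W, (f ^ k) w = 0 → b w (f x) = 0 := by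
    intro k
    induction k with
    | zero => intro w _ h0; simp at h0; simp [h0]
    | succ k ih =>
      intro w hw h0
      have e1 := h.rel w x
      rw [hx _ (hW w hw), ih (f w) (hW w hw) (by rw [← Module.End.mul_apply, ← pow_succ]; exact h0)]
        at e1
      simpa using e1
  obtain ⟨N, hN⟩ := hf
  intro w hw
  exact key N w hw (by rw [hN]; rfl)

theorem range_equiv {P : Type*} [AddCommGroup P] [Module K P] (Φ : P →ₗ[K] V) (Φ' : P →ₗ[K] V')
    (hk : ∀ p, Φ p = 0 ↔ Φ' p = 0) :
    ∃ e : LinearMap.range Φ ≃ₗ[K] LinearMap.range Φ',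
      ∀ p (hp : Φ p ∈ LinearMap.range Φ), (e ⟨Φ p, hp⟩ : V') = Φ' p := by
  have hker : LinearMap.ker Φ = LinearMap.ker Φ' := by ext p; simp [hk]
  refine ⟨Φ.quotKerEquivRange.symm ≪≫ₗ Submodule.quotEquivOfEq _ _ hker ≪≫ₗ
    Φ'.quotKerEquivRange, ?_⟩
  intro p hp
  simp [LinearMap.quotKerEquivRange_symm_apply_image]

theorem restrict_pow_coe {C : Submodule K V} (hC : ∀ x ∈ C, f x ∈ C) (d : ℕ) (x : C) :
    ((((f.restrict hC) ^ d) x : C) : V) = (f ^ d) x := by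
  induction d generalizing x with
  | zero => simp
  | succ d ih => rw [pow_succ, pow_succ, Module.End.mul_apply, Module.End.mul_apply, ih]; rfl

theorem finrank_restrict {C : Submodule K V} (hC : ∀ x ∈ C, f x ∈ C) (d : ℕ) :
    finrank K (LinearMap.range ((f.restrict hC) ^ d)) = finrank K (C.map (f ^ d)) := by
  rw [← Submodule.finrank_map_subtype_eq]
  have : Submodule.map C.subtype (LinearMap.range ((f.restrict hC) ^ d)) = C.map (f ^ d) := by
    ext y
    simp only [Submodule.mem_map, LinearMap.mem_range, Submodule.subtype_apply]
    constructor
    · rintro ⟨z, ⟨x, rfl⟩, rfl⟩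
      exact ⟨x, x.2, (restrict_pow_coe hC d x).symm⟩
    · rintro ⟨x, hx, rfl⟩
      exact ⟨_, ⟨⟨x, hx⟩, rfl⟩, restrict_pow_coe hC d ⟨x, hx⟩⟩
  rw [this]

theorem rank_split [FiniteDimensional K V] {W C : Submodule K V} (hWC : IsCompl W C)
    (hW : ∀ x ∈ W, f x ∈ W) (hC : ∀ x ∈ C, f x ∈ C) (d : ℕ) :
    finrank K (LinearMap.range (f ^ d)) = finrank K (W.map (f ^ d)) + finrank K (C.map (f ^ d)) := by
  rw [← Submodule.finrank_sup_add_finrank_inf_eq, ← Submodule.map_sup, hWC.sup_eq_top,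
    Submodule.map_top]
  have : W.map (f ^ d) ⊓ C.map (f ^ d) = ⊥ := by
    rw [eq_bot_iff, ← hWC.inf_eq_bot]
    apply inf_le_inf
    · rintro _ ⟨x, hx, rfl⟩; exact sub_inv_pow hW d x hx
    · rintro _ ⟨x, hx, rfl⟩; exact sub_inv_pow hC d x hx
  rw [this]; simp

/-- the two systems are isometric -/
def Concl (b : V →ₗ[K] V →ₗ[K] K) (f : V →ₗ[K] V) (b' : V' →ₗ[K] V' →ₗ[K] K)
    (f' : V' →ₗ[K] V') : Prop :=
  ∃ g : V ≃ₗ[K] V', (∀ x y, b' (g x) (g y) = b x y) ∧ ∀ x, g (f x) = f' (g x)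

/-- full hypotheses -/
structure Sys (b : V →ₗ[K] V →ₗ[K] K) (f : V →ₗ[K] V) : Prop extends SpFrm b f where
  nd : ∀ v, (∀ w, b v w = 0) → v = 0
  nil : IsNilpotent f

/-- equal invariants -/
structure Same (b : V →ₗ[K] V →ₗ[K] K) (f : V →ₗ[K] V) (b' : V' →ₗ[K] V' →ₗ[K] K)
    (f' : V' →ₗ[K] V') : Prop where
  rk : ∀ d, finrank K (LinearMap.range (f ^ d)) = finrank K (LinearMap.range (f' ^ d))
  ep : ∀ e, (∃ x, (f ^ (e + 1)) x = 0 ∧ b ((f ^ e) x) x ≠ 0) ↔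
    (∃ x, (f' ^ (e + 1)) x = 0 ∧ b' ((f' ^ e) x) x ≠ 0)

theorem glue {W C : Submodule K V} {W' C' : Submodule K V'} (hc : IsCompl W C)
    (hc' : IsCompl W' C') (h : SpFrm b f) (h' : SpFrm b' f')
    (ho : ∀ w ∈ W, ∀ c ∈ C, b w c = 0) (ho' : ∀ w ∈ W', ∀ c ∈ C', b' w c = 0)
    (hW : ∀ x ∈ W, f x ∈ W) (hC : ∀ x ∈ C, f x ∈ C)
    (e₁ : W ≃ₗ[K] W') (e₂ : C ≃ₗ[K] C')
    (i₁ : ∀ x y, b' (e₁ x) (e₁ y) = b x y) (i₂ : ∀ x y, b' (e₂ x) (e₂ y) = b x y)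
    (q₁ : ∀ x : W, (e₁ ⟨f x, hW x x.2⟩ : V') = f' (e₁ x))
    (q₂ : ∀ x : C, (e₂ ⟨f x, hC x x.2⟩ : V') = f' (e₂ x)) : Concl b f b' f' := by
  let g : V ≃ₗ[K] V' := (Submodule.prodEquivOfIsCompl W C hc).symm ≪≫ₗ
    (e₁.prodCongr e₂) ≪≫ₗ (Submodule.prodEquivOfIsCompl W' C' hc')
  have hg : ∀ (w : W) (c : C), g (w + c) = e₁ w + e₂ c := by
    intro w c
    have : (Submodule.prodEquivOfIsCompl W C hc).symm (w + c) = (w, c) := by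
      rw [LinearEquiv.symm_apply_eq]; simp
    simp [g, this]
  have hd : ∀ x : V, ∃ (w : W) (c : C), x = w + c := by
    intro x
    obtain ⟨y, hy⟩ := (Submodule.prodEquivOfIsCompl W C hc).surjective x
    exact ⟨y.1, y.2, by rw [← hy]; simp⟩
  refine ⟨g, ?_, ?_⟩
  · intro x y
    obtain ⟨w, c, rfl⟩ := hd x
    obtain ⟨w', c', rfl⟩ := hd y
    rw [hg, hg]
    simp only [map_add, LinearMap.add_apply, i₁, i₂]
    rw [ho' _ (e₁ w).2 _ (e₂ c').2, h'.symm (e₂ c), ho' _ (e₁ w').2 _ (e₂ c).2,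
      ho _ w.2 _ c'.2, h.symm c w', ho _ w'.2 _ c.2]
  · intro x
    obtain ⟨w, c, rfl⟩ := hd x
    rw [hg, map_add f, map_add f', ← q₁, ← q₂]
    exact hg ⟨f w, hW w w.2⟩ ⟨f c, hC c c.2⟩

theorem Sys.restrict (h : Sys b f) {W C : Submodule K V} (hc : IsCompl W C)
    (ho : ∀ w ∈ W, ∀ c ∈ C, b w c = 0) (hC : ∀ x ∈ C, f x ∈ C) :
    Sys (b.domRestrict₁₂ C C) (f.restrict hC) where
  alt v := h.alt _
  rel x y := h.rel _ _
  nd v hv := by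
    apply Subtype.ext
    apply h.nd
    intro w
    have : w ∈ W ⊔ C := by rw [hc.sup_eq_top]; trivial
    obtain ⟨w1, hw1, c, hcc, rfl⟩ := Submodule.mem_sup.1 this
    rw [map_add, h.symm, ho _ hw1 _ v.2, zero_add]
    exact hv ⟨c, hcc⟩
  nil := by
    obtain ⟨N, hN⟩ := h.nil
    refine ⟨N, ?_⟩
    ext x
    rw [restrict_pow_coe, hN]; rfl

theorem eps_complement (h : SpFrm b f) {W C : Submodule K V} (hc : IsCompl W C)
    (ho : ∀ w ∈ W, ∀ c ∈ C, b w c = 0) (hW : ∀ x ∈ W, f x ∈ W) (hC : ∀ x ∈ C, f x ∈ C) {e : ℕ}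
    (hWe : ∀ x ∈ W, (f ^ (e + 1)) x = 0 → b ((f ^ e) x) x = 0) :
    (∃ x : C, ((f.restrict hC) ^ (e + 1)) x = 0 ∧
      b.domRestrict₁₂ C C (((f.restrict hC) ^ e) x) x ≠ 0) ↔
    (∃ x, (f ^ (e + 1)) x = 0 ∧ b ((f ^ e) x) x ≠ 0) := by
  constructor
  · rintro ⟨x, h1, h2⟩
    refine ⟨x, ?_, ?_⟩
    · rw [← restrict_pow_coe hC, h1]; rfl
    · rw [← restrict_pow_coe hC]; exact h2
  · rintro ⟨x, h1, h2⟩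
    have : x ∈ W ⊔ C := by rw [hc.sup_eq_top]; trivial
    obtain ⟨w, hw, c, hcc, rfl⟩ := Submodule.mem_sup.1 this
    have h3 : (f ^ (e + 1)) w = 0 ∧ (f ^ (e + 1)) c = 0 := by
      have m1 := sub_inv_pow hW (e + 1) w hw
      have m2 := sub_inv_pow hC (e + 1) c hcc
      rw [map_add] at h1
      have m3 : (f ^ (e + 1)) w = 0 := by
        have : (f ^ (e + 1)) w ∈ W ⊓ C := ⟨m1, by
          rw [eq_neg_of_add_eq_zero_left h1]; exact C.neg_mem m2⟩
        rw [hc.inf_eq_bot] at this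
        simpa using this
      exact ⟨m3, by simpa [m3] using h1⟩
    refine ⟨⟨c, hcc⟩, ?_, ?_⟩
    · apply Subtype.ext; rw [restrict_pow_coe]; exact h3.2
    · have e2 : b.domRestrict₁₂ C C (((f.restrict hC) ^ e) ⟨c, hcc⟩) ⟨c, hcc⟩
          = b ((f ^ e) c) c := by
        rw [LinearMap.domRestrict₁₂_apply, restrict_pow_coe]
      rw [e2]
      simp only [map_add, LinearMap.add_apply] at h2
      rw [hWe w hw h3.1, ho _ (sub_inv_pow hW e w hw) _ hcc, h.symm, ho _ hw _ (sub_inv_pow hC e c hcc)]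
        at h2
      simpa using h2

theorem eps_complement_top {C : Submodule K V} (hC : ∀ x ∈ C, f x ∈ C) {n : ℕ}
    (hn : f ^ (n + 1) = 0) :
    (∃ x : C, ((f.restrict hC) ^ (n + 1)) x = 0 ∧
      b.domRestrict₁₂ C C (((f.restrict hC) ^ n) x) x ≠ 0) ↔
    (∃ x ∈ C, b ((f ^ n) x) x ≠ 0) := by
  constructor
  · rintro ⟨x, h1, h2⟩
    exact ⟨x, x.2, by rw [← restrict_pow_coe hC]; exact h2⟩
  · rintro ⟨x, hx, h2⟩
    refine ⟨⟨x, hx⟩, ?_, ?_⟩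
    · apply Subtype.ext; rw [restrict_pow_coe, hn]; rfl
    · rw [LinearMap.domRestrict₁₂_apply, restrict_pow_coe]; exact h2

theorem pow_intertwine {P : Type*} [AddCommGroup P] [Module K P] (T : P →ₗ[K] P)
    (Φ : P →ₗ[K] V) (hΦ : ∀ p, Φ (T p) = f (Φ p)) (d : ℕ) (p : P) :
    Φ ((T ^ d) p) = (f ^ d) (Φ p) := by
  induction d generalizing p with
  | zero => simp
  | succ d ih => rw [pow_succ, Module.End.mul_apply, ih, hΦ, pow_succ, Module.End.mul_apply]

theorem step [FiniteDimensional K V] [FiniteDimensional K V'] (h : Sys b f) (h' : Sys b' f')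
    {n : ℕ} (hn : f ^ (n + 1) = 0) (hn' : f' ^ (n + 1) = 0) (hs : Same b f b' f')
    {P : Type*} [AddCommGroup P] [Module K P] (T : P →ₗ[K] P)
    (Φ : P →ₗ[K] V) (Φ' : P →ₗ[K] V') (hΦ : ∀ p, Φ (T p) = f (Φ p))
    (hΦ' : ∀ p, Φ' (T p) = f' (Φ' p))
    (gram : ∀ p q, b (Φ p) (Φ q) = b' (Φ' p) (Φ' q))
    (hN : NCond b f n (LinearMap.range Φ)) (hN' : NCond b' f' n (LinearMap.range Φ'))
    (epn : (∃ x, (∀ p, b (Φ p) x = 0) ∧ b ((f ^ n) x) x ≠ 0) ↔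
      (∃ x, (∀ p, b' (Φ' p) x = 0) ∧ b' ((f' ^ n) x) x ≠ 0))
    (hne : ∃ p, Φ p ≠ 0)
    (IH : ∀ (C : Submodule K V) (C' : Submodule K V') (c : C →ₗ[K] C →ₗ[K] K) (g : C →ₗ[K] C)
      (c' : C' →ₗ[K] C' →ₗ[K] K) (g' : C' →ₗ[K] C'), finrank K C < finrank K V →
      Sys c g → Sys c' g' → Same c g c' g' → Concl c g c' g') : Concl b f b' f' := by
  obtain ⟨U, hU⟩ := exists_invOf h.nil
  obtain ⟨U', hU'⟩ := exists_invOf h'.nil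
  have hW : ∀ x ∈ LinearMap.range Φ, f x ∈ LinearMap.range Φ := by
    rintro _ ⟨p, rfl⟩; exact ⟨T p, hΦ p⟩
  have hW' : ∀ x ∈ LinearMap.range Φ', f' x ∈ LinearMap.range Φ' := by
    rintro _ ⟨p, rfl⟩; exact ⟨T p, hΦ' p⟩
  have nd := h.nondeg_sub hU hn hW hN
  have nd' := h'.nondeg_sub hU' hn' hW' hN'
  have hc := h.isCompl nd
  have hc' := h'.isCompl nd'
  set C := LinearMap.BilinForm.orthogonal b (LinearMap.range Φ) with hCdef
  set C' := LinearMap.BilinForm.orthogonal b' (LinearMap.range Φ') with hCdef'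
  have ho : ∀ w ∈ LinearMap.range Φ, ∀ c ∈ C, b w c = 0 := fun w hw c hc => hc w hw
  have ho' : ∀ w ∈ LinearMap.range Φ', ∀ c ∈ C', b' w c = 0 := fun w hw c hc => hc w hw
  have hC : ∀ x ∈ C, f x ∈ C := fun x hx => h.orth_inv h.nil hW x hx
  have hC' : ∀ x ∈ C', f' x ∈ C' := fun x hx => h'.orth_inv h'.nil hW' x hx
  have hk : ∀ p, Φ p = 0 ↔ Φ' p = 0 := by
    intro p
    constructor
    · intro hp
      refine nd' _ ⟨p, rfl⟩ ?_
      rintro _ ⟨q, rfl⟩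
      rw [← gram, hp]; simp
    · intro hp
      refine nd _ ⟨p, rfl⟩ ?_
      rintro _ ⟨q, rfl⟩
      rw [gram, hp]; simp
  obtain ⟨e₁, he₁⟩ := range_equiv Φ Φ' hk
  have mC : ∀ x, x ∈ C ↔ ∀ p, b (Φ p) x = 0 := fun x =>
    ⟨fun hx p => hx _ ⟨p, rfl⟩, fun hx => by rintro _ ⟨p, rfl⟩; exact hx p⟩
  have mC' : ∀ x, x ∈ C' ↔ ∀ p, b' (Φ' p) x = 0 := fun x =>
    ⟨fun hx p => hx _ ⟨p, rfl⟩, fun hx => by rintro _ ⟨p, rfl⟩; exact hx p⟩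
  have hlt : finrank K C < finrank K V := by
    apply Submodule.finrank_lt
    intro htop
    obtain ⟨p, hp⟩ := hne
    apply hp
    have := hc.inf_eq_bot
    rw [htop, inf_top_eq] at this
    have h2 : Φ p ∈ LinearMap.range Φ := ⟨p, rfl⟩
    rw [this] at h2
    simpa using h2
  have hsame : Same (b.domRestrict₁₂ C C) (f.restrict hC) (b'.domRestrict₁₂ C' C')
      (f'.restrict hC') := by
    constructor
    · intro d
      rw [finrank_restrict, finrank_restrict]
      have e1 := rank_split hc hW hC d
      have e2 := rank_split hc' hW' hC' d
      have e3 : finrank K ((LinearMap.range Φ).map (f ^ d))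
          = finrank K ((LinearMap.range Φ').map (f' ^ d)) := by
        rw [← LinearMap.range_comp, ← LinearMap.range_comp]
        obtain ⟨e, -⟩ := range_equiv ((f ^ d).comp Φ) ((f' ^ d).comp Φ') (fun p => by
          rw [LinearMap.comp_apply, LinearMap.comp_apply, ← pow_intertwine T Φ hΦ,
            ← pow_intertwine T Φ' hΦ', hk])
        exact e.finrank_eq
      have := hs.rk d
      omega
    · intro e
      by_cases hen : e = n
      · subst hen
        rw [eps_complement_top hC hn, eps_complement_top hC' hn']
        simpa only [mC, mC'] using epn
      · rw [eps_complement h.toSpFrm hc ho hW hC (h.eps_sub hU hn hN hen),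
          eps_complement h'.toSpFrm hc' ho' hW' hC' (h'.eps_sub hU' hn' hN' hen)]
        exact hs.ep e
  obtain ⟨e₂, i₂, q₂⟩ := IH C C' _ _ _ _ hlt (h.restrict hc ho hC) (h'.restrict hc' ho' hC') hsame
  have he : ∀ (x : LinearMap.range Φ) p, (x : V) = Φ p → (e₁ x : V') = Φ' p := by
    rintro ⟨x, hx⟩ p hp
    have hp2 : x = Φ p := hp
    subst hp2
    exact he₁ p hx
  refine glue hc hc' h.toSpFrm h'.toSpFrm ho ho' hW hC e₁ e₂ ?_ i₂ ?_ ?_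
  · intro x y
    obtain ⟨p, hp⟩ := x.2
    obtain ⟨q, hq⟩ := y.2
    rw [he x p hp.symm, he y q hq.symm, ← hp, ← hq, gram]
  · intro x
    obtain ⟨p, hp⟩ := x.2
    rw [he x p hp.symm, he _ (T p) (by rw [hΦ, hp]), hΦ']
  · intro x
    exact congrArg Subtype.val (q₂ x)

end Split

set_option linter.unusedSectionVars false

section Gen
variable {K : Type*} [Field K] [CharP K 2]
variable {V : Type*} [AddCommGroup V] [Module K V]
variable {V' : Type*} [AddCommGroup V'] [Module K V']
variable {b : V →ₗ[K] V →ₗ[K] K} {f U : V →ₗ[K] V}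
variable {b' : V' →ₗ[K] V' →ₗ[K] K} {f' : V' →ₗ[K] V'}
variable {ι : Type} [Fintype ι]

/-- the map from a free object to the span of the `f^k (v i)` -/
noncomputable def gen (f : V →ₗ[K] V) (v : ι → V) : (ι × ℕ →₀ K) →ₗ[K] V :=
  Finsupp.linearCombination K (fun p : ι × ℕ => (f ^ p.2) (v p.1))

/-- shift -/
noncomputable def shiftMap (K : Type*) [Field K] (ι : Type) :
    (ι × ℕ →₀ K) →ₗ[K] (ι × ℕ →₀ K) :=
  Finsupp.lmapDomain K K (fun p : ι × ℕ => (p.1, p.2 + 1))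

theorem gen_single (v : ι → V) (i : ι) (k : ℕ) (a : K) :
    gen f v (Finsupp.single (i, k) a) = a • (f ^ k) (v i) := by
  simp [gen]

theorem gen_shift (v : ι → V) (p : ι × ℕ →₀ K) :
    gen f v (shiftMap K ι p) = f (gen f v p) := by
  have : (gen f v).comp (shiftMap K ι) = f.comp (gen f v) := by
    ext ⟨i, k⟩
    simp [gen, shiftMap, pow_succ']
  exact congrArg (fun g => g p) this

theorem gen_gram (v : ι → V) (v' : ι → V')
    (h : ∀ i j a c, b ((f ^ a) (v i)) ((f ^ c) (v j)) = b' ((f' ^ a) (v' i)) ((f' ^ c) (v' j)))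
    (p q : ι × ℕ →₀ K) : b (gen f v p) (gen f v q) = b' (gen f' v' p) (gen f' v' q) := by
  have : b.compl₁₂ (gen f v) (gen f v) = b'.compl₁₂ (gen f' v') (gen f' v') := by
    ext ⟨i, k⟩ ⟨j, l⟩
    simp [gen, h]
  exact congrArg (fun g => g p q) this

theorem gen_decomp (v : ι → V) (p : ι × ℕ →₀ K) :
    ∃ α : ι → K, ∃ q, gen f v p = ∑ i, α i • v i + f (gen f v q) := by
  classical
  induction p using Finsupp.induction_linear with
  | zero => exact ⟨0, 0, by simp⟩
  | add p q hp hq =>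
    obtain ⟨α, r, h1⟩ := hp
    obtain ⟨β, s, h2⟩ := hq
    refine ⟨α + β, r + s, ?_⟩
    simp only [map_add, h1, h2, Pi.add_apply, add_smul, Finset.sum_add_distrib]
    abel
  | single p a =>
    obtain ⟨i, k⟩ := p
    cases k with
    | zero =>
      refine ⟨Pi.single i a, 0, ?_⟩
      rw [gen_single, Finset.sum_eq_single i]
      · simp
      · intro j _ hj; simp [hj]
      · simp
    | succ k =>
      refine ⟨0, Finsupp.single (i, k) a, ?_⟩
      simp [gen_single, pow_succ']

theorem gen_N {n : ℕ} (hn : f ^ (n + 1) = 0) (v : ι → V)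
    (hv : ∀ α : ι → K, (∀ j, ∑ i, α i * b ((f ^ n) (v i)) (v j) = 0) → α = 0) :
    NCond b f n (LinearMap.range (gen f v)) := by
  rintro _ ⟨p, rfl⟩ h
  obtain ⟨α, q, e⟩ := gen_decomp (f := f) v p
  refine ⟨gen f v q, ⟨q, rfl⟩, ?_⟩
  have : α = 0 := by
    apply hv
    intro j
    have h1 := h (v j) ⟨Finsupp.single (j, 0) 1, by simp [gen_single]⟩
    rw [e, map_add, ← Module.End.mul_apply (f ^ n) f, ← pow_succ, hn] at h1
    simpa [map_sum, LinearMap.sum_apply] using h1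
  rw [e, this]; simp

theorem gen_orth (v : ι → V) (x : V) (h : ∀ i k, b ((f ^ k) (v i)) x = 0) (p : ι × ℕ →₀ K) :
    b (gen f v p) x = 0 := by
  induction p using Finsupp.induction_linear with
  | zero => simp
  | add p q hp hq => simp [hp, hq]
  | single p a => obtain ⟨i, k⟩ := p; simp [gen_single, h]

/-- orthogonal pair of anisotropic vectors for the top form -/
theorem Sys.pick (h : Sys b f) {n : ℕ} (hn : f ^ (n + 1) = 0) (v₀ : V)
    (hv₀ : b ((f ^ n) v₀) v₀ ≠ 0) (hr : ¬ finrank K (LinearMap.range (f ^ n)) ≤ 1) :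
    ∃ v x, b ((f ^ n) v) v ≠ 0 ∧ b ((f ^ n) x) x ≠ 0 ∧ b ((f ^ n) v) x = 0 := by
  obtain ⟨U, hU⟩ := exists_invOf h.nil
  by_contra hcon
  push Not at hcon
  have hsy := h.B_symm hU hn
  have q0 : ∀ x, b ((f ^ n) v₀) x = 0 → b ((f ^ n) x) x = 0 := by
    intro x hx
    by_contra hx2
    exact hcon v₀ x hv₀ hx2 hx
  apply hr
  have hyz : ∀ y z, b ((f ^ n) v₀) y = 0 → b ((f ^ n) v₀) z = 0 → b ((f ^ n) y) z = 0 := by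
    intro y z hy hz
    by_contra hyz
    set t := b ((f ^ n) y) z
    set q := b ((f ^ n) v₀) v₀
    have a1 : b ((f ^ n) y) v₀ = 0 := by rw [hsy, hy]
    have a2 : b ((f ^ n) z) v₀ = 0 := by rw [hsy, hz]
    refine hcon (v₀ + y) (v₀ - (q / t) • z) ?_ ?_ ?_
    · simp [hy, a1, q0 y hy]; exact hv₀
    · simp [hz, a2, q0 z hz]; exact hv₀
    · simp only [map_add, map_sub, map_smul, LinearMap.add_apply, hz, a1, smul_eq_mul]
      change q + 0 - q / t * (0 + t) = 0
      rw [add_zero, zero_add, div_mul_cancel₀ q hyz, sub_self]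
  refine finrank_le_one (⟨(f ^ n) v₀, v₀, rfl⟩ : LinearMap.range (f ^ n)) ?_
  rintro ⟨_, x, rfl⟩
  set q := b ((f ^ n) v₀) v₀ with hq
  refine ⟨b ((f ^ n) v₀) x / q, Subtype.ext ?_⟩
  have pr : ∀ x, b ((f ^ n) v₀) (x - (b ((f ^ n) v₀) x / q) • v₀) = 0 := by
    intro x
    rw [map_sub, map_smul, smul_eq_mul, ← hq]
    field_simp
    ring
  have : (f ^ n) (x - (b ((f ^ n) v₀) x / q) • v₀) = 0 := by
    apply h.nd
    intro z
    have e1 := hyz _ _ (pr x) (pr z)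
    have e2 : b ((f ^ n) (x - (b ((f ^ n) v₀) x / q) • v₀)) v₀ = 0 := by rw [hsy, pr]
    rw [map_sub, map_smul, e2, smul_zero, sub_zero] at e1
    exact e1
  rw [map_sub, map_smul, sub_eq_zero] at this
  simp [this]

theorem Sys.caseA [FiniteDimensional K V] [IsAlgClosed K] (h : Sys b f) {n k : ℕ}
    (hn : f ^ (n + 1) = 0) (hk : n = 2 * k + 1)
    (hq : ∃ v, b ((f ^ n) v) v ≠ 0) :
    ∃ v : V, b ((f ^ n) v) v = 1 ∧
      (∀ i, b ((f ^ (i + 1)) v) ((f ^ i) v) = if i = k then 1 else 0) ∧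
      ((∃ x, (∀ p, b (gen f (fun _ : Unit => v) p) x = 0) ∧ b ((f ^ n) x) x ≠ 0) ↔
        ¬ finrank K (LinearMap.range (f ^ n)) ≤ 1) := by
  obtain ⟨U, hU⟩ := exists_invOf h.nil
  have main : ∃ v : V, b ((f ^ n) v) v = 1 ∧
      (∀ i, b ((f ^ (i + 1)) v) ((f ^ i) v) = if i = k then 1 else 0) ∧
      (¬ finrank K (LinearMap.range (f ^ n)) ≤ 1 →
        ∃ x, b ((f ^ n) v) x = 0 ∧ b ((f ^ n) x) x ≠ 0) := by
    have one : ∀ v, b ((f ^ n) v) v ≠ 0 → ∃ v' : V, ∃ c : K, ∃ y : V, v' = c • v + f y ∧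
        b ((f ^ n) v') v' = 1 ∧
        (∀ i, b ((f ^ (i + 1)) v') ((f ^ i) v') = if i = k then 1 else 0) := by
      intro v hv
      subst hk
      obtain ⟨v', c, y, h1, h2⟩ := h.cyc_normal hU hn v hv
      refine ⟨v', c, y, h1, ?_, h2⟩
      rw [← h.b_top hU hn (show k + 1 + k = 2 * k + 1 by omega), h2, if_pos rfl]
    by_cases hr : finrank K (LinearMap.range (f ^ n)) ≤ 1
    · obtain ⟨v, hv⟩ := hq
      obtain ⟨v', c, y, h1, h2, h3⟩ := one v hv
      exact ⟨v', h2, h3, fun h => absurd hr h⟩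
    · obtain ⟨v₀, hv₀⟩ := hq
      obtain ⟨v, x, hv, hx, hvx⟩ := h.pick hn v₀ hv₀ hr
      obtain ⟨v', c, y, h1, h2, h3⟩ := one v hv
      refine ⟨v', h2, h3, fun _ => ⟨x, ?_, hx⟩⟩
      rw [h1, map_add, ← Module.End.mul_apply (f ^ n) f, ← pow_succ, hn]
      simp [hvx]
  obtain ⟨v, h1, h2, h3⟩ := main
  refine ⟨v, h1, h2, ?_, ?_⟩
  · rintro ⟨x, hx, hxx⟩ hr
    obtain ⟨⟨v0, hv0⟩, hr⟩ := finrank_le_one_iff.1 hr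
    obtain ⟨c, hc⟩ := hr ⟨(f ^ n) v, v, rfl⟩
    obtain ⟨d, hd⟩ := hr ⟨(f ^ n) x, x, rfl⟩
    replace hc := congrArg Subtype.val hc
    replace hd := congrArg Subtype.val hd
    simp only [Submodule.coe_smul] at hc hd
    have e1 := hx (Finsupp.single ((), n) 1)
    rw [gen_single, one_smul, ← hc] at e1
    rw [← hc] at h1
    rw [← hd] at hxx
    simp only [map_smul, LinearMap.smul_apply, smul_eq_mul] at e1 h1 hxx
    rcases mul_eq_zero.1 e1 with h0 | h0
    · simp [h0] at h1
    · simp [h0] at hxx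
  · intro hr
    obtain ⟨x, hx, hxx⟩ := h3 hr
    have hW : ∀ x ∈ LinearMap.range (gen f (fun _ : Unit => v)),
        f x ∈ LinearMap.range (gen f (fun _ : Unit => v)) := by
      rintro _ ⟨p, rfl⟩; exact ⟨shiftMap K Unit p, gen_shift _ _⟩
    have hN : NCond b f n (LinearMap.range (gen f (fun _ : Unit => v))) := by
      apply gen_N hn
      intro α hα
      have := hα ()
      funext i
      simpa [h1] using this
    have hc := h.isCompl (h.nondeg_sub hU hn hW hN)
    have : x ∈ LinearMap.range (gen f (fun _ : Unit => v)) ⊔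
      LinearMap.BilinForm.orthogonal b (LinearMap.range (gen f (fun _ : Unit => v))) := by
      rw [hc.sup_eq_top]; trivial
    obtain ⟨_, ⟨p, rfl⟩, z, hz, rfl⟩ := Submodule.mem_sup.1 this
    have hz' : ∀ p, b (gen f (fun _ : Unit => v) p) z = 0 := fun p => hz _ ⟨p, rfl⟩
    refine ⟨z, hz', ?_⟩
    obtain ⟨α, q, e⟩ := gen_decomp (f := f) (fun _ : Unit => v) p
    have e0 : b ((f ^ n) v) z = 0 := by
      have := hz' (Finsupp.single ((), n) 1)
      simpa [gen_single] using this
    have e3 : ∀ y, b ((f ^ n) (gen f (fun _ : Unit => v) p)) y = α () * b ((f ^ n) v) y := by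
      intro y
      rw [e, map_add, ← Module.End.mul_apply (f ^ n) f, ← pow_succ, hn]
      simp
    have e4 : α () = 0 := by
      rw [map_add, e0, add_zero, h.B_symm hU hn, e3, h1, mul_one] at hx
      exact hx
    have e5 : b ((f ^ n) z) (gen f (fun _ : Unit => v) p) = 0 := by
      rw [h.B_symm hU hn, e3, e4, zero_mul]
    simp only [map_add, LinearMap.add_apply, e3, e4, e5] at hxx
    simpa using hxx

end Gen

universe u v w

theorem classify {K : Type w} [Field K] [CharP K 2] [IsAlgClosed K] (N : ℕ) :
    ∀ (V : Type u) (V' : Type v) [AddCommGroup V] [AddCommGroup V'] [Module K V] [Module K V']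
      [FiniteDimensional K V] [FiniteDimensional K V']
      (b : V →ₗ[K] V →ₗ[K] K) (f : V →ₗ[K] V) (b' : V' →ₗ[K] V' →ₗ[K] K) (f' : V' →ₗ[K] V'),
      finrank K V = N → Sys b f → Sys b' f' → Same b f b' f' → Concl b f b' f' := by
  induction N using Nat.strong_induction_on with
  | _ N ih =>
  intro V V' _ _ _ _ _ _ b f b' f' hN h h' hs
  have IH : ∀ (C : Submodule K V) (C' : Submodule K V') (c : C →ₗ[K] C →ₗ[K] K) (g : C →ₗ[K] C)
      (c' : C' →ₗ[K] C' →ₗ[K] K) (g' : C' →ₗ[K] C'), finrank K C < finrank K V →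
      Sys c g → Sys c' g' → Same c g c' g' → Concl c g c' g' :=
    fun C C' c g c' g' hlt => ih _ (by omega) C C' c g c' g' rfl
  have zero_iff : ∀ d, f ^ d = 0 ↔ f' ^ d = 0 := by
    intro d
    rw [← LinearMap.range_eq_bot, ← LinearMap.range_eq_bot, ← Submodule.finrank_eq_zero (R := K),
      ← Submodule.finrank_eq_zero (R := K), hs.rk]
  obtain ⟨U, hU⟩ := exists_invOf h.nil
  obtain ⟨U', hU'⟩ := exists_invOf h'.nil
  classical
  have hex : ∃ d, f ^ d = 0 := h.nil
  rcases hm : Nat.find hex with _ | n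
  · -- trivial space
    have h0 : f ^ 0 = 0 := by rw [← hm]; exact Nat.find_spec hex
    have h0' := (zero_iff 0).1 h0
    have t : ∀ x : V, x = 0 := fun x => by
      have := congrArg (fun g : V →ₗ[K] V => g x) h0
      simpa using this
    have t' : ∀ x : V', x = 0 := fun x => by
      have := congrArg (fun g : V' →ₗ[K] V' => g x) h0'
      simpa using this
    have : Subsingleton V := ⟨fun x y => by rw [t x, t y]⟩
    have : Subsingleton V' := ⟨fun x y => by rw [t' x, t' y]⟩
    exact ⟨0, fun x y => by rw [t x]; simp, fun x => Subsingleton.elim _ _⟩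
  have hn : f ^ (n + 1) = 0 := by rw [← hm]; exact Nat.find_spec hex
  have hn0 : f ^ n ≠ 0 := Nat.find_min hex (by omega)
  have hn' := (zero_iff _).1 hn
  have hn0' : f' ^ n ≠ 0 := fun e => hn0 ((zero_iff _).2 e)
  have hep := hs.ep n
  simp only [hn, hn', LinearMap.zero_apply, true_and] at hep
  by_cases hq : ∃ v, b ((f ^ n) v) v ≠ 0
  · have hq' := hep.1 hq
    obtain ⟨k, hk⟩ : ∃ k, n = 2 * k + 1 := by
      rcases Nat.even_or_odd' n with ⟨k, hk | hk⟩
      · obtain ⟨v, hv⟩ := hq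
        exfalso; apply hv
        rw [← h.b_top hU hn (show k + k = n by omega), h.alt]
      · exact ⟨k, hk⟩
    obtain ⟨v, a1, a2, a3⟩ := h.caseA hn hk hq
    obtain ⟨v', a1', a2', a3'⟩ := h'.caseA hn' hk hq'
    refine step h h' hn hn' hs (shiftMap K Unit) (gen f (fun _ : Unit => v))
      (gen f' (fun _ : Unit => v')) (gen_shift _) (gen_shift _) (gen_gram _ _ ?_)
      (gen_N hn _ ?_) (gen_N hn' _ ?_) ?_ ?_ IH
    · intro _ _ a c
      exact gram_one (fun a c => b ((f ^ a) v) ((f ^ c) v)) (fun a c => b' ((f' ^ a) v') ((f' ^ c) v'))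
        (fun _ _ => h.symm _ _) (fun _ _ => h'.symm _ _) (fun _ => h.alt _) (fun _ => h'.alt _)
        (h.gram_rel v v) (h'.gram_rel v' v') (fun i => by rw [a2, a2']) a c
    · intro α hα
      have := hα ()
      funext i
      simpa [a1] using this
    · intro α hα
      have := hα ()
      funext i
      simpa [a1'] using this
    · rw [a3, a3', hs.rk]
    · refine ⟨Finsupp.single ((), n) 1, ?_⟩
      rw [gen_single, one_smul]
      intro h0
      rw [h0] at a1
      simp at a1
  · have hq' := fun hh => hq (hep.2 hh)
    have hb : ∀ x, b ((f ^ n) x) x = 0 := by push Not at hq; exact hq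
    have hb' : ∀ x, b' ((f' ^ n) x) x = 0 := by
      intro x; by_contra hx; exact hq' ⟨x, hx⟩
    have ex : ∃ v w, b ((f ^ n) v) w = 1 := by
      by_contra hcon
      apply hn0
      ext v
      apply h.nd
      intro w
      by_contra hw
      apply hcon
      refine ⟨v, (b ((f ^ n) v) w)⁻¹ • w, ?_⟩
      rw [map_smul, smul_eq_mul, inv_mul_cancel₀ hw]
    have ex' : ∃ v w, b' ((f' ^ n) v) w = 1 := by
      by_contra hcon
      apply hn0'
      ext v
      apply h'.nd
      intro w
      by_contra hw
      apply hcon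
      refine ⟨v, (b' ((f' ^ n) v) w)⁻¹ • w, ?_⟩
      rw [map_smul, smul_eq_mul, inv_mul_cancel₀ hw]
    obtain ⟨v0, w0, hvw0⟩ := ex
    obtain ⟨v0', w0', hvw0'⟩ := ex'
    obtain ⟨v, w, hv, hw, hvw⟩ := h.pair_normal hU hn hb v0 w0 hvw0
    obtain ⟨v', w', hv', hw', hvw'⟩ := h'.pair_normal hU' hn' hb' v0' w0' hvw0'
    have hn1 : b ((f ^ n) v) w = 1 := by rw [hvw, if_pos rfl]
    have hn1' : b' ((f' ^ n) v') w' = 1 := by rw [hvw', if_pos rfl]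
    have gvw : ∀ a c, b ((f ^ a) v) ((f ^ c) w) = b' ((f' ^ a) v') ((f' ^ c) w') :=
      gram_two (fun a c => b ((f ^ a) v) ((f ^ c) w)) (fun a c => b' ((f' ^ a) v') ((f' ^ c) w'))
        (n + 1) (fun a c ha => by simp [pow_big hn ha]) (fun a c ha => by simp [pow_big hn' ha])
        (h.gram_rel v w) (h'.gram_rel v' w') (fun a => by simp [hvw, hvw'])
    refine step h h' hn hn' hs (shiftMap K Bool) (gen f (fun i : Bool => cond i v w))
      (gen f' (fun i : Bool => cond i v' w')) (gen_shift _) (gen_shift _) (gen_gram _ _ ?_)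
      (gen_N hn _ ?_) (gen_N hn' _ ?_) ?_ ?_ IH
    · intro i j a c
      cases i <;> cases j
      · simp [hw, hw']
      · simp only [cond_true, cond_false]
        rw [h.symm, h'.symm, gvw]
      · exact gvw a c
      · simp [hv, hv']
    · intro α hα
      have c1 := hα true
      have c2 := hα false
      have hs1 := h.B_symm hU hn w v
      rw [hn1] at hs1
      simp [hb, hn1, hs1] at c1 c2
      funext i
      cases i <;> assumption
    · intro α hα
      have c1 := hα true
      have c2 := hα false
      have hs1 := h'.B_symm hU' hn' w' v'
      rw [hn1'] at hs1
      simp [hb', hn1', hs1] at c1 c2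
      funext i
      cases i <;> assumption
    · simp [hb, hb']
    · refine ⟨Finsupp.single (true, n) 1, ?_⟩
      rw [gen_single, one_smul]
      intro h0
      simp only [cond_true] at h0
      rw [h0] at hn1
      simp at hn1

theorem rank_rec {K : Type*} [Field K] {V : Type*} [AddCommGroup V] [Module K V]
    [FiniteDimensional K V] (f : V →ₗ[K] V) (d : ℕ) :
    finrank K (LinearMap.range (f ^ d)) = finrank K (LinearMap.range (f ^ (d + 1)))
      + finrank K (LinearMap.ker (f.domRestrict (LinearMap.range (f ^ d)))) := by
  rw [← LinearMap.finrank_range_add_finrank_ker (f.domRestrict (LinearMap.range (f ^ d))),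
    LinearMap.range_domRestrict, ← LinearMap.range_comp, pow_succ']
  rfl

theorem rank_convex {K : Type*} [Field K] {V : Type*} [AddCommGroup V] [Module K V]
    [FiniteDimensional K V] (f : V →ₗ[K] V) (d : ℕ) :
    2 * finrank K (LinearMap.range (f ^ (d + 1))) ≤ finrank K (LinearMap.range (f ^ d))
      + finrank K (LinearMap.range (f ^ (d + 2))) := by
  have h1 := rank_rec f d
  have h2 := rank_rec f (d + 1)
  have h3 : finrank K (LinearMap.ker (f.domRestrict (LinearMap.range (f ^ (d + 1)))))
      ≤ finrank K (LinearMap.ker (f.domRestrict (LinearMap.range (f ^ d)))) := by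
    have key : ∀ k, finrank K (LinearMap.ker (f.domRestrict (LinearMap.range (f ^ k))))
        = finrank K (LinearMap.ker f ⊓ LinearMap.range (f ^ k) : Submodule K V) := by
      intro k
      rw [← Submodule.finrank_map_subtype_eq]
      have : Submodule.map (LinearMap.range (f ^ k)).subtype
          (LinearMap.ker (f.domRestrict (LinearMap.range (f ^ k))))
          = LinearMap.ker f ⊓ LinearMap.range (f ^ k) := by
        ext x
        constructor
        · rintro ⟨y, hy, rfl⟩
          exact ⟨hy, y.2⟩
        · rintro ⟨h1, h2⟩
          exact ⟨⟨x, h2⟩, h1, rfl⟩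
      rw [this]
    rw [key, key]
    apply Submodule.finrank_mono
    apply inf_le_inf_left
    rintro _ ⟨x, rfl⟩
    exact ⟨f x, by rw [← Module.End.mul_apply, ← pow_succ]⟩
  rw [show d + 1 + 1 = d + 2 from rfl] at h2
  omega


theorem sys_of_sp {K : Type*} [Field K]
    {V : Type*} [AddCommGroup V] [Module K V]
    (b : V →ₗ[K] V →ₗ[K] K) (halt : ∀ v, b v v = 0) (hnd : ∀ v, (∀ w, b v w = 0) → v = 0)
    (u : V ≃ₗ[K] V) (hu : ∀ v w, b (u v) (u w) = b v w)
    (huni : IsUnipotent K (u : V →ₗ[K] V)) : Sys b ((u : V →ₗ[K] V) - 1) where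
  alt := halt
  rel x y := by
    simp only [LinearMap.sub_apply, LinearEquiv.coe_coe, Module.End.one_apply, map_sub, hu]
    ring
  nd := hnd
  nil := huni

theorem ranks_eq {K : Type*} [Field K] {V : Type*} [AddCommGroup V] [Module K V]
    [FiniteDimensional K V] (f f' : V →ₗ[K] V) (hf : IsNilpotent f) (hf' : IsNilpotent f')
    (h : ∀ d : ℕ, 1 ≤ d → jordanMult K f d = jordanMult K f' d) (d : ℕ) :
    finrank K (LinearMap.range (f ^ d)) = finrank K (LinearMap.range (f' ^ d)) := by
  obtain ⟨N, hN⟩ := hf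
  obtain ⟨N', hN'⟩ := hf'
  have key : ∀ t d, N + N' ≤ d + t →
      finrank K (LinearMap.range (f ^ d)) = finrank K (LinearMap.range (f' ^ d)) := by
    intro t
    induction t using Nat.strong_induction_on with
    | _ t ih =>
    intro d hd
    by_cases hd2 : N + N' ≤ d
    · rw [pow_eq_zero_of_le (by omega) hN, pow_eq_zero_of_le (by omega) hN']
    · have e1 := ih (t - 1) (by omega) (d + 1) (by omega)
      have e2 := ih (t - 1) (by omega) (d + 2) (by omega)
      have e3 := h (d + 1) (by omega)
      have e4 := rank_convex f d
      have e5 := rank_convex f' d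
      unfold jordanMult at e3
      rw [Nat.add_sub_cancel, show d + 1 + 1 = d + 2 from rfl] at e3
      omega
  exact key (N + N') d (by omega)

/-- classification of unipotent conjugacy classes in Sp(V,b), char 2:
two unipotent elements of `Sp(V,b)` are conjugate in `Sp(V,b)` if and only if they have the
same Jordan block multiplicities and the same invariants `ε_{V,b}(d)` for all `d ≥ 1`. -/
theorem sp_conjugacy_classification
    (K : Type*) [Field K] [IsAlgClosed K] [CharP K 2]
    (V : Type*) [AddCommGroup V] [Module K V] [FiniteDimensional K V]
    (b : V →ₗ[K] V →ₗ[K] K)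
    (halt : ∀ v, b v v = 0)
    (hnd : ∀ v, (∀ w, b v w = 0) → v = 0)
    (u u' : V ≃ₗ[K] V)
    (hu : ∀ v w, b (u v) (u w) = b v w)
    (hu' : ∀ v w, b (u' v) (u' w) = b v w)
    (huni : IsUnipotent K (u : V →ₗ[K] V))
    (huni' : IsUnipotent K (u' : V →ₗ[K] V)) :
    (∃ g : V ≃ₗ[K] V, (∀ v w, b (g v) (g w) = b v w) ∧ ∀ v, g (u (g.symm v)) = u' v) ↔
      (∀ d : ℕ, 1 ≤ d →
        jordanMult K ((u : V →ₗ[K] V) - 1) d = jordanMult K ((u' : V →ₗ[K] V) - 1) d ∧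
        eps K ((u : V →ₗ[K] V) - 1) b d = eps K ((u' : V →ₗ[K] V) - 1) b d) := by
  have h := sys_of_sp b halt hnd u hu huni
  have h' := sys_of_sp b halt hnd u' hu' huni'
  have hf : ∀ x, ((u : V →ₗ[K] V) - 1) x = u x - x := fun x => rfl
  have hf' : ∀ x, ((u' : V →ₗ[K] V) - 1) x = u' x - x := fun x => rfl
  generalize (u : V →ₗ[K] V) - 1 = f at *
  generalize (u' : V →ₗ[K] V) - 1 = f' at *
  constructor
  · rintro ⟨g, hg, hgu⟩
    have c1 : ∀ x, f' (g x) = g (f x) := by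
      intro x
      rw [hf, hf', map_sub, ← hgu, g.symm_apply_apply]
    have c : ∀ d x, (f' ^ d) (g x) = g ((f ^ d) x) := by
      intro d
      induction d with
      | zero => intro x; simp
      | succ d ih => intro x; rw [pow_succ, pow_succ, Module.End.mul_apply, c1, ih]; rfl
    have rk : ∀ d, finrank K (LinearMap.range (f ^ d)) = finrank K (LinearMap.range (f' ^ d)) := by
      intro d
      have : LinearMap.range (f' ^ d) = (LinearMap.range (f ^ d)).map (g : V →ₗ[K] V) := by
        ext y
        constructor
        · rintro ⟨x, rfl⟩
          refine ⟨(f ^ d) (g.symm x), ⟨_, rfl⟩, ?_⟩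
          rw [LinearEquiv.coe_coe, ← c, g.apply_symm_apply]
        · rintro ⟨_, ⟨x, rfl⟩, rfl⟩
          exact ⟨g x, c d x⟩
      rw [this, LinearEquiv.finrank_map_eq]
    intro d _
    refine ⟨by simp only [jordanMult, rk], ?_⟩
    have : (∃ v : V, (f ^ d) v = 0 ∧ b ((f ^ (d - 1)) v) v ≠ 0) ↔
        (∃ v : V, (f' ^ d) v = 0 ∧ b ((f' ^ (d - 1)) v) v ≠ 0) := by
      constructor
      · rintro ⟨v, h1, h2⟩
        exact ⟨g v, by rw [c, h1, map_zero], by rwa [c, hg]⟩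
      · rintro ⟨v, h1, h2⟩
        obtain ⟨v, rfl⟩ := g.surjective v
        rw [c] at h1 h2
        rw [hg] at h2
        exact ⟨v, by simpa using h1, h2⟩
    unfold eps
    split_ifs with h1 h2 h2
    · rfl
    · exact absurd (this.1 h1) h2
    · exact absurd (this.2 h2) h1
    · rfl
  · intro H
    have hs : Same b f b f' := by
      refine ⟨ranks_eq f f' h.nil h'.nil fun d hd => (H d hd).1, fun e => ?_⟩
      have := (H (e + 1) (by omega)).2
      unfold eps at this
      rw [Nat.add_sub_cancel] at this
      split_ifs at this with h1 h2 h2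
      · exact ⟨fun _ => h2, fun _ => h1⟩
      · exact ⟨fun h => absurd h h1, fun h => absurd h h2⟩
    obtain ⟨g, hg, hgf⟩ := classify _ V V b f b f' rfl h h' hs
    refine ⟨g, hg, fun v => ?_⟩
    have := hgf (g.symm v)
    rw [hf, hf', map_sub, g.apply_symm_apply] at this
    exact sub_left_injective this
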